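/- arXiv:2002.09845 — 8 statements merged into one kernel-verified Lean document; each statement's English description precedes it below -/
import Mathlib

section
/- Let P₀, P₁, P₂ be affinely independent points of ℝ². Let M₀ be a point of the line P₀P₁ with M₀ ∉ {P₀, P₁}, and M₁ a point of the line P₁P₂ with M₁ ∉ {P₁, P₂}, such that M₀ ≠ M₁ and the line M₀M₁ contains none of P₀, P₁, P₂. Let M₂ be a point of the line P₂P₀ such that the quadruple of lines through M₁, (M₀M₁, M₁M₂; M₁P₀, P₁P₂), is harmonic. Then the quadruple of lines through M₂, (M₁M₂, M₂M₀; M₂P₁, P₂P₀), is harmonic, and the quadruple of lines through M₀, (M₂M₀, M₀M₁; M₀P₂, P₀P₁), is harmonic. In other words, every such pair (M₀, M₁) determines a 3-periodic orbit (M₀, M₁, M₂) of the right-spherical billiard S(P₀,P₁,P₂), so the right-spherical billiard is 3-reflective. -/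
/-- The affine line of `ℝ²` through the points `A` and `B`, as a set of points. -/
def lineThrough (A B : ℝ × ℝ) : Set (ℝ × ℝ) :=
  {X | ∃ t : ℝ, X = A + t • (B - A)}

/-- Four lines through a common point, with respective direction vectors `d₁ d₂ d₃ d₄`,
form a harmonic quadruple `(ℓ₁, ℓ₂; ℓ₃, ℓ₄) = -1`: the first two lines admit direction
vectors of the form `a • d₃ + b • d₄` and `a • d₃ - b • d₄` with `a, b` nonzero scalars. -/
def HarmonicLines (d₁ d₂ d₃ d₄ : ℝ × ℝ) : Prop :=
  ∃ a b : ℝ, a ≠ 0 ∧ b ≠ 0 ∧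
    (∃ s : ℝ, s ≠ 0 ∧ d₁ = s • (a • d₃ + b • d₄)) ∧
    (∃ t : ℝ, t ≠ 0 ∧ d₂ = t • (a • d₃ - b • d₄))

/-- If `M₀, M₁, M₂` on the sides of the triangle satisfy Ceva's relation, then the lines at `M₁`
are harmonic. -/
theorem harmonicLines_of_ceva (P₀ P₁ P₂ : ℝ × ℝ) {x y z : ℝ}
    (hx0 : x ≠ 0) (hx1 : 1 - x ≠ 0) (hy : y ≠ 0) (hz : z ≠ 0)
    (hceva : (1 - x) * (1 - y) * (1 - z) = x * y * z) :
    HarmonicLines (P₀ + x • (P₁ - P₀) - (P₁ + y • (P₂ - P₁)))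
      (P₂ + z • (P₀ - P₂) - (P₁ + y • (P₂ - P₁)))
      (P₀ - (P₁ + y • (P₂ - P₁))) (P₂ - P₁) := by
  refine ⟨1 - x, -(x * y), hx1, neg_ne_zero.mpr (mul_ne_zero hx0 hy),
    ⟨1, one_ne_zero, by module⟩, ⟨z / (1 - x), div_ne_zero hz hx1, ?_⟩⟩
  have h₁ : z / (1 - x) * (1 - x) = z := div_mul_cancel₀ z hx1
  have h₂ : z / (1 - x) * (x * y) = (1 - y) * (1 - z) := by
    field_simp
    linear_combination -hceva
  rw [neg_smul, sub_neg_eq_add, smul_add, smul_smul, smul_smul, h₁, h₂]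
  module

theorem AffineIndependent.smul_sub_add_smul_sub_eq_zero {P₀ P₁ P₂ : ℝ × ℝ}
    (hind : AffineIndependent ℝ ![P₀, P₁, P₂]) {a b : ℝ}
    (h : a • (P₁ - P₀) + b • (P₂ - P₀) = 0) : a = 0 ∧ b = 0 := by
  have key := affineIndependent_iff.mp hind Finset.univ ![-a - b, a, b]
    (by simp [Fin.sum_univ_three]; ring)
    (by
      simp only [Fin.sum_univ_three, Matrix.cons_val]
      rw [← h]
      module)
  exact ⟨key 1 (Finset.mem_univ _), key 2 (Finset.mem_univ _)⟩

/-- If the lines at `M₁` are harmonic, then `M₀, M₁, M₂` satisfy Ceva's relation, and `M₂` is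
not a vertex of the triangle. -/
theorem ceva_of_harmonicLines {P₀ P₁ P₂ : ℝ × ℝ} {x y z : ℝ}
    (hind : AffineIndependent ℝ ![P₀, P₁, P₂])
    (h : HarmonicLines (P₀ + x • (P₁ - P₀) - (P₁ + y • (P₂ - P₁)))
      (P₂ + z • (P₀ - P₂) - (P₁ + y • (P₂ - P₁)))
      (P₀ - (P₁ + y • (P₂ - P₁))) (P₂ - P₁)) :
    (1 - x) * (1 - y) * (1 - z) = x * y * z ∧ z ≠ 0 ∧ 1 - z ≠ 0 := by
  obtain ⟨a, b, ha, hb, ⟨s, -, h₁⟩, ⟨t, ht, h₂⟩⟩ := h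
  obtain ⟨e₁, e₂⟩ := hind.smul_sub_add_smul_sub_eq_zero
    (a := x - 1 + y - s * a * (y - 1) + s * b) (b := -y + s * a * y - s * b) (by
      rw [← sub_eq_zero] at h₁
      rw [← h₁]
      module)
  obtain ⟨e₃, e₄⟩ := hind.smul_sub_add_smul_sub_eq_zero
    (a := y - 1 - t * a * (y - 1) - t * b) (b := 1 - z - y + t * a * y + t * b) (by
      rw [← sub_eq_zero] at h₂
      rw [← h₂]
      module)
  have hsa : s * a = 1 - x := by linear_combination e₁ + e₂
  have hsb : s * b = -(x * y) := by linear_combination y * hsa - e₂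
  have hta : t * a = z := by linear_combination e₃ + e₄
  have htb : t * b = -((1 - y) * (1 - z)) := by linear_combination e₄ - y * hta
  refine ⟨?_, hta ▸ mul_ne_zero ht ha, fun hz => mul_ne_zero ht hb (by rw [htb, hz]; ring)⟩
  linear_combination (-(1 - y) * (1 - z)) * hsa + s * a * htb - t * a * hsb + x * y * hta

/-- The right-spherical billiard `S(P₀,P₁,P₂)` is 3-reflective: any admissible pair
`(M₀, M₁)` determines a 3-periodic orbit `(M₀, M₁, M₂)`. -/
theorem rightSpherical_three_reflective
    (P₀ P₁ P₂ M₀ M₁ M₂ : ℝ × ℝ)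
    (hind : AffineIndependent ℝ ![P₀, P₁, P₂])
    (hM₀ : M₀ ∈ lineThrough P₀ P₁) (hM₀0 : M₀ ≠ P₀) (hM₀1 : M₀ ≠ P₁)
    (hM₁ : M₁ ∈ lineThrough P₁ P₂) (hM₁1 : M₁ ≠ P₁) (hM₁2 : M₁ ≠ P₂)
    (hMM : M₀ ≠ M₁)
    (h0 : P₀ ∉ lineThrough M₀ M₁) (h1 : P₁ ∉ lineThrough M₀ M₁)
    (h2 : P₂ ∉ lineThrough M₀ M₁)
    (hM₂ : M₂ ∈ lineThrough P₂ P₀)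
    (hrefl₁ : HarmonicLines (M₀ - M₁) (M₂ - M₁) (P₀ - M₁) (P₂ - P₁)) :
    HarmonicLines (M₁ - M₂) (M₀ - M₂) (P₁ - M₂) (P₀ - P₂) ∧
      HarmonicLines (M₂ - M₀) (M₁ - M₀) (P₂ - M₀) (P₁ - P₀) := by
  obtain ⟨x, rfl⟩ := hM₀
  obtain ⟨y, rfl⟩ := hM₁
  obtain ⟨z, rfl⟩ := hM₂
  have hx0 : x ≠ 0 := by
    rintro rfl
    exact hM₀0 (by module)
  have hx1 : 1 - x ≠ 0 := fun h => hM₀1 (by rw [← sub_eq_zero.mp h]; module)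
  have hy0 : y ≠ 0 := by
    rintro rfl
    exact hM₁1 (by module)
  have hy1 : 1 - y ≠ 0 := fun h => hM₁2 (by rw [← sub_eq_zero.mp h]; module)
  obtain ⟨hceva, hz0, hz1⟩ := ceva_of_harmonicLines hind hrefl₁
  exact ⟨harmonicLines_of_ceva P₁ P₂ P₀ hy0 hy1 hz0 hx0 (by linear_combination hceva),
    harmonicLines_of_ceva P₂ P₀ P₁ hz0 hz1 hx0 hy0 (by linear_combination hceva)⟩
end

section
/- Let P₀, P₁, P₂, P₃ be four points of ℝ², no three of which are collinear, such that the diagonal lines P₀P₂ and P₁P₃ are not parallel; let O be their intersection point. Let M₀ be a point of the line P₀P₁ and M₁ a point of the line P₁P₂, with M₀ ≠ M₁, both distinct from the vertices P₀, P₁, P₂, P₃ and from O. Suppose M₂ is a point of line P₂P₃ such that the quadruple of lines through M₁, (M₀M₁, M₁M₂; M₁O, P₁P₂), is harmonic; M₃ is a point of line P₃P₀ such that (M₁M₂, M₂M₃; M₂O, P₂P₃) is harmonic; and M₃' is a point of line P₃P₀ such that (M₀M₁, M₀M₃'; M₀O, P₀P₁) is harmonic. Assume moreover that none of the lines M₀M₁,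 M₁M₂, M₂M₃, M₀M₃' is parallel to either diagonal line P₀P₂ or P₁P₃. Then M₃ = M₃' and the quadruple of lines through M₃, (M₂M₃, M₃M₀; M₃O, P₃P₀), is harmonic. Hence every such pair (M₀, M₁) determines a 4-periodic orbit (M₀, M₁, M₂, M₃) of the centrally-projective quadrilateral CPol(O; P₀, P₁, P₂, P₃), which is therefore 4-reflective. -/
theorem exists_dual_basis_of_not_parallel {u v : ℝ × ℝ} (hv : v ≠ 0)
    (huv : ¬ ∃ t : ℝ, u = t • v) :
    ∃ x y : ℝ × ℝ →ₗ[ℝ] ℝ, x u = 1 ∧ x v = 0 ∧ y u = 0 ∧ y v = 1 ∧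
      ∀ w, w = x w • u + y w • v := by
  obtain ⟨u₁, u₂⟩ := u
  obtain ⟨v₁, v₂⟩ := v
  have hD : u₁ * v₂ - u₂ * v₁ ≠ 0 := by
    intro hD
    apply huv
    by_cases h₁ : v₁ = 0
    · have h₂ : v₂ ≠ 0 := fun h₂ => hv (by simp [h₁, h₂])
      refine ⟨u₂ / v₂, Prod.ext ?_ ?_⟩ <;> simp <;> field_simp <;> linarith
    · refine ⟨u₁ / v₁, Prod.ext ?_ ?_⟩ <;> simp <;> field_simp <;> linarith
  refine ⟨(u₁ * v₂ - u₂ * v₁)⁻¹ • (v₂ • LinearMap.fst ℝ ℝ ℝ - v₁ • LinearMap.snd ℝ ℝ ℝ),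
    (u₁ * v₂ - u₂ * v₁)⁻¹ • (u₁ • LinearMap.snd ℝ ℝ ℝ - u₂ • LinearMap.fst ℝ ℝ ℝ),
    ?_, ?_, ?_, ?_, fun w => Prod.ext ?_ ?_⟩ <;> simp <;> field_simp <;> ring_nf <;> simp

/-- In the dual plane at `O`, where a line is the functional taking the value `1` on it,
reflection in the side `s` is the point reflection `f ↦ 2 s - f`. -/
theorem HarmonicLines.reflected_apply {s f : ℝ × ℝ →ₗ[ℝ] ℝ} {A B M O d : ℝ × ℝ}
    (h : HarmonicLines (A - M) (B - M) (O - M) d) (hs : s (M - O) = 1) (hd : s d = 0)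
    (hA : f (A - O) = 1) (hM : f (M - O) = 1) : ((2 : ℝ) • s - f) (B - O) = 1 := by
  obtain ⟨a, b, -, -, ⟨σ, hσ, h₁⟩, τ, -, h₂⟩ := h
  have e₁ := congrArg f h₁
  have e₂ := congrArg f h₂
  have e₃ := congrArg s h₂
  simp only [map_sub, map_add, map_smul, smul_eq_mul, LinearMap.sub_apply,
    LinearMap.smul_apply] at *
  have e : a * (f O - f M) + b * f d = 0 :=
    (mul_eq_zero.mp (by rw [← e₁]; linarith)).resolve_left hσ
  rw [hd] at e₃
  linear_combination 2 * e₃ - e₂ + (2 - 2 * τ * a) * hs + (2 * τ * a - 1) * hM + τ * e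

/-- A line reflected at a point of a side not containing `O` does not contain `O` itself. -/
theorem HarmonicLines.exists_functional {s : ℝ × ℝ →ₗ[ℝ] ℝ} {A B M O d : ℝ × ℝ}
    (h : HarmonicLines (A - M) (B - M) (O - M) d) (hs : s (M - O) = 1) (hd : s d = 0)
    (hd₀ : d ≠ 0) : ∃ f : ℝ × ℝ →ₗ[ℝ] ℝ, f (A - O) = 1 ∧ f (M - O) = 1 := by
  obtain ⟨a, b, -, hb, ⟨σ, -, h₁⟩, -⟩ := h
  have hpar : ¬ ∃ t : ℝ, M - O = t • d := by
    rintro ⟨t, ht⟩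
    rw [ht, map_smul, hd, smul_zero] at hs
    exact zero_ne_one hs
  obtain ⟨-, g, -, -, hgM, hgd, -⟩ := exists_dual_basis_of_not_parallel hd₀ hpar
  have hfM : (s + (a / b) • g) (M - O) = 1 := by simp [hs, hgM, -map_sub]
  refine ⟨s + (a / b) • g, ?_, hfM⟩
  have hfO : (s + (a / b) • g) (O - M) = -1 := by rw [← neg_sub, map_neg, hfM]
  have hfd : (s + (a / b) • g) d = a / b := by simp [hd, hgd]
  rw [← sub_add_sub_cancel A M O, map_add, hfM, h₁, map_smul, map_add, map_smul, map_smul,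
    hfO, hfd]
  simp only [smul_eq_mul]
  field_simp
  ring

/-- Two vectors of the plane agree when two independent functionals agree on them. -/
theorem eq_of_functionals {s f : ℝ × ℝ →ₗ[ℝ] ℝ} {d e w z : ℝ × ℝ}
    (hsd : s d = 0) (hfd : f d ≠ 0) (hse : s e ≠ 0) (hs : s w = s z) (hf : f w = f z) :
    w = z := by
  have hpar : ¬ ∃ t : ℝ, e = t • d := by
    rintro ⟨t, rfl⟩
    simp [hsd] at hse
  have hd₀ : d ≠ 0 := by
    rintro rfl
    simp at hfd
  obtain ⟨x, y, -, -, -, -, hxy⟩ := exists_dual_basis_of_not_parallel hd₀ hpar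
  have hdec := hxy (w - z)
  have h₁ := congrArg s hdec
  have h₂ := congrArg f hdec
  rw [map_sub, hs, sub_self, map_add, map_smul, map_smul, hsd, smul_zero, add_zero, eq_comm,
    smul_eq_zero, or_iff_left hse] at h₁
  rw [map_sub, hf, sub_self, map_add, map_smul, map_smul, h₁, zero_smul, zero_add, eq_comm,
    smul_eq_zero, or_iff_left hfd] at h₂
  rw [h₁, h₂, zero_smul, zero_smul, add_zero, sub_eq_zero] at hdec
  exact hdec

/-- Converse of `HarmonicLines.reflected_apply`. -/
theorem harmonicLines_of_reflected_apply {s f : ℝ × ℝ →ₗ[ℝ] ℝ} {A B M O d : ℝ × ℝ}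
    (hs : s (M - O) = 1) (hsd : s d = 0) (hfd : f d ≠ 0)
    (hA : f (A - O) = 1) (hM : f (M - O) = 1) (hB : ((2 : ℝ) • s - f) (B - O) = 1)
    (hAM : A ≠ M) (hBM : B ≠ M) : HarmonicLines (A - M) (B - M) (O - M) d := by
  have hsO : s (O - M) = -1 := by rw [← neg_sub, map_neg, hs]
  have hfO : f (O - M) = -1 := by rw [← neg_sub, map_neg, hM]
  have hsO₀ : s (O - M) ≠ 0 := by rw [hsO]; norm_num
  have hfA : f (A - M) = 0 := by rw [← sub_sub_sub_cancel_right A M O, map_sub, hA, hM, sub_self]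
  have hfB : f (B - M) = 2 * s (B - M) := by
    rw [← sub_sub_sub_cancel_right B M O, map_sub f, map_sub s, hs, hM]
    rw [LinearMap.sub_apply, LinearMap.smul_apply, smul_eq_mul] at hB
    linarith
  have e₁ : A - M = (-s (A - M) / f d) • (f d • (O - M) + (1 : ℝ) • d) := by
    refine eq_of_functionals hsd hfd hsO₀ ?_ ?_
    · rw [map_smul, map_add, map_smul, map_smul, hsO, hsd]
      simp only [smul_eq_mul]
      field_simp
      ring
    · rw [map_smul, map_add, map_smul, map_smul, hfO, hfA]
      simp only [smul_eq_mul]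
      ring
  have e₂ : B - M = (-s (B - M) / f d) • (f d • (O - M) - (1 : ℝ) • d) := by
    refine eq_of_functionals hsd hfd hsO₀ ?_ ?_
    · rw [map_smul, map_sub s (f d • _), map_smul, map_smul, hsO, hsd]
      simp only [smul_eq_mul]
      field_simp
      ring
    · rw [map_smul, map_sub f (f d • _), map_smul, map_smul, hfO, hfB]
      simp only [smul_eq_mul]
      field_simp
      ring
  refine ⟨f d, 1, hfd, one_ne_zero, ⟨_, fun h => ?_, e₁⟩, _, fun h => ?_, e₂⟩
  · rw [h, zero_smul, sub_eq_zero] at e₁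
    exact hAM e₁
  · rw [h, zero_smul, sub_eq_zero] at e₂
    exact hBM e₂

theorem collinear_of_mem_lineThrough {A B X : ℝ × ℝ} (h : X ∈ lineThrough A B) :
    Collinear ℝ {X, A, B} := by
  obtain ⟨t, rfl⟩ := h
  apply collinear_insert_of_mem_affineSpan_pair
  convert AffineMap.lineMap_mem_affineSpan_pair t A B using 1
  rw [AffineMap.lineMap_apply, vsub_eq_sub, vadd_eq_add, add_comm]

theorem functional_apply_of_mem_lineThrough {s : ℝ × ℝ →ₗ[ℝ] ℝ} {A B O X : ℝ × ℝ}
    (hA : s (A - O) = 1) (hB : s (B - O) = 1) (hX : X ∈ lineThrough A B) : s (X - O) = 1 := by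
  obtain ⟨t, rfl⟩ := hX
  simp only [map_sub, map_add, map_smul, smul_eq_mul] at *
  linear_combination (1 - t) * hA + t * hB

theorem functional_sub_of_apply_eq_one {s : ℝ × ℝ →ₗ[ℝ] ℝ} {A B O : ℝ × ℝ}
    (hA : s (A - O) = 1) (hB : s (B - O) = 1) : s (B - A) = 0 := by
  rw [← sub_sub_sub_cancel_right B A O, map_sub, hA, hB, sub_self]

/-- The side functionals of a quadrilateral whose diagonals meet at `O`; in the dual plane at
`O` they form a parallelogram. -/
theorem exists_side_functionals {P₀ P₁ P₂ P₃ O : ℝ × ℝ}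
    (h012 : ¬ Collinear ℝ {P₀, P₁, P₂}) (h013 : ¬ Collinear ℝ {P₀, P₁, P₃})
    (h023 : ¬ Collinear ℝ {P₀, P₂, P₃}) (h123 : ¬ Collinear ℝ {P₁, P₂, P₃})
    (hdiag : ¬ ∃ t : ℝ, P₂ - P₀ = t • (P₃ - P₁))
    (hO02 : O ∈ lineThrough P₀ P₂) (hO13 : O ∈ lineThrough P₁ P₃) :
    ∃ s₀ s₁ s₂ s₃ : ℝ × ℝ →ₗ[ℝ] ℝ, s₀ + s₂ = s₁ + s₃ ∧
      (s₀ (P₀ - O) = 1 ∧ s₀ (P₁ - O) = 1) ∧ (s₁ (P₁ - O) = 1 ∧ s₁ (P₂ - O) = 1) ∧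
      (s₂ (P₂ - O) = 1 ∧ s₂ (P₃ - O) = 1) ∧ (s₃ (P₃ - O) = 1 ∧ s₃ (P₀ - O) = 1) := by
  have hP : P₃ - P₁ ≠ 0 := by
    intro h
    rw [sub_eq_zero.mp h, Set.pair_eq_singleton] at h013
    exact h013 (collinear_pair ℝ _ _)
  obtain ⟨x, y, hxu, hxv, hyu, hyv, -⟩ := exists_dual_basis_of_not_parallel hP hdiag
  have n₀ : O ≠ P₀ := by
    rintro rfl
    exact h013 (collinear_of_mem_lineThrough hO13)
  have n₂ : O ≠ P₂ := by
    rintro rfl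
    exact h123 (by simpa [Set.insert_comm] using collinear_of_mem_lineThrough hO13)
  have n₁ : O ≠ P₁ := by
    rintro rfl
    exact h012 (by simpa [Set.insert_comm] using collinear_of_mem_lineThrough hO02)
  have n₃ : O ≠ P₃ := by
    rintro rfl
    refine h023 ?_
    convert collinear_of_mem_lineThrough hO02 using 1
    ext
    simp
    tauto
  obtain ⟨t, ht⟩ := hO02
  obtain ⟨r, hr⟩ := hO13
  have e₀ : P₀ - O = (-t) • (P₂ - P₀) := by rw [ht]; module
  have e₂ : P₂ - O = (1 - t) • (P₂ - P₀) := by rw [ht]; module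
  have e₁ : P₁ - O = (-r) • (P₃ - P₁) := by rw [hr]; module
  have e₃ : P₃ - O = (1 - r) • (P₃ - P₁) := by rw [hr]; module
  have t₀ : -t ≠ 0 := fun h => n₀ (by rw [h, zero_smul, sub_eq_zero] at e₀; exact e₀.symm)
  have t₂ : 1 - t ≠ 0 := fun h => n₂ (by rw [h, zero_smul, sub_eq_zero] at e₂; exact e₂.symm)
  have r₁ : -r ≠ 0 := fun h => n₁ (by rw [h, zero_smul, sub_eq_zero] at e₁; exact e₁.symm)
  have r₃ : 1 - r ≠ 0 := fun h => n₃ (by rw [h, zero_smul, sub_eq_zero] at e₃; exact e₃.symm)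
  refine ⟨(-t)⁻¹ • x + (-r)⁻¹ • y, (1 - t)⁻¹ • x + (-r)⁻¹ • y, (1 - t)⁻¹ • x + (1 - r)⁻¹ • y,
    (-t)⁻¹ • x + (1 - r)⁻¹ • y, by abel, ?_⟩
  rw [e₀, e₁, e₂, e₃]
  simp only [LinearMap.add_apply, LinearMap.smul_apply, map_smul, smul_eq_mul, hxu, hxv, hyu, hyv,
    mul_one, mul_zero, add_zero, zero_add, mul_inv_cancel₀ t₀, mul_inv_cancel₀ t₂,
    mul_inv_cancel₀ r₁, mul_inv_cancel₀ r₃, and_self]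

/-- The centrally-projective quadrilateral `CPol(O; P₀,P₁,P₂,P₃)`, with `O` the
intersection point of the diagonals, is 4-reflective: any admissible pair `(M₀, M₁)`
determines a 4-periodic orbit `(M₀, M₁, M₂, M₃)`. -/
theorem centrallyProjective_quadrilateral_four_reflective
    (P₀ P₁ P₂ P₃ O M₀ M₁ M₂ M₃ M₃' : ℝ × ℝ)
    (h012 : ¬ Collinear ℝ {P₀, P₁, P₂}) (h013 : ¬ Collinear ℝ {P₀, P₁, P₃})
    (h023 : ¬ Collinear ℝ {P₀, P₂, P₃}) (h123 : ¬ Collinear ℝ {P₁, P₂, P₃})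
    (hdiag : ¬ ∃ t : ℝ, P₂ - P₀ = t • (P₃ - P₁))
    (hO02 : O ∈ lineThrough P₀ P₂) (hO13 : O ∈ lineThrough P₁ P₃)
    (hM₀ : M₀ ∈ lineThrough P₀ P₁) (hM₁ : M₁ ∈ lineThrough P₁ P₂)
    (hne : M₀ ≠ M₁)
    (hM₀v : M₀ ≠ P₀ ∧ M₀ ≠ P₁ ∧ M₀ ≠ P₂ ∧ M₀ ≠ P₃ ∧ M₀ ≠ O)
    (hM₁v : M₁ ≠ P₀ ∧ M₁ ≠ P₁ ∧ M₁ ≠ P₂ ∧ M₁ ≠ P₃ ∧ M₁ ≠ O)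
    (hM₂ : M₂ ∈ lineThrough P₂ P₃)
    (hrefl₁ : HarmonicLines (M₀ - M₁) (M₂ - M₁) (O - M₁) (P₂ - P₁))
    (hM₃ : M₃ ∈ lineThrough P₃ P₀)
    (hrefl₂ : HarmonicLines (M₁ - M₂) (M₃ - M₂) (O - M₂) (P₃ - P₂))
    (hM₃' : M₃' ∈ lineThrough P₃ P₀)
    (hrefl₀ : HarmonicLines (M₁ - M₀) (M₃' - M₀) (O - M₀) (P₁ - P₀))
    (hnpar01 : ¬ ∃ t : ℝ, M₁ - M₀ = t • (P₂ - P₀))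
    (hnpar01' : ¬ ∃ t : ℝ, M₁ - M₀ = t • (P₃ - P₁))
    (hnpar12 : ¬ ∃ t : ℝ, M₂ - M₁ = t • (P₂ - P₀))
    (hnpar12' : ¬ ∃ t : ℝ, M₂ - M₁ = t • (P₃ - P₁))
    (hnpar23 : ¬ ∃ t : ℝ, M₃ - M₂ = t • (P₂ - P₀))
    (hnpar23' : ¬ ∃ t : ℝ, M₃ - M₂ = t • (P₃ - P₁))
    (hnpar03 : ¬ ∃ t : ℝ, M₃' - M₀ = t • (P₂ - P₀))
    (hnpar03' : ¬ ∃ t : ℝ, M₃' - M₀ = t • (P₃ - P₁)) :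
    M₃ = M₃' ∧ HarmonicLines (M₂ - M₃) (M₀ - M₃) (O - M₃) (P₀ - P₃) := by
  obtain ⟨s₀, s₁, s₂, s₃, hs, ⟨s₀0, s₀1⟩, ⟨s₁1, s₁2⟩, ⟨s₂2, s₂3⟩, s₃3, s₃0⟩ :=
    exists_side_functionals h012 h013 h023 h123 hdiag hO02 hO13
  have hd₀ : P₁ - P₀ ≠ 0 := by
    intro h
    rw [sub_eq_zero.mp h, Set.insert_eq_of_mem (Set.mem_insert _ _)] at h012
    exact h012 (collinear_pair ℝ _ _)
  have m₀ := functional_apply_of_mem_lineThrough s₀0 s₀1 hM₀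
  have m₁ := functional_apply_of_mem_lineThrough s₁1 s₁2 hM₁
  have m₂ := functional_apply_of_mem_lineThrough s₂2 s₂3 hM₂
  have m₃ := functional_apply_of_mem_lineThrough s₃3 s₃0 hM₃
  have m₃' := functional_apply_of_mem_lineThrough s₃3 s₃0 hM₃'
  have k₀ := functional_sub_of_apply_eq_one s₀0 s₀1
  have k₁ := functional_sub_of_apply_eq_one s₁1 s₁2
  have k₂ := functional_sub_of_apply_eq_one s₂2 s₂3
  have k₃ := functional_sub_of_apply_eq_one s₃3 s₃0
  obtain ⟨f, f₁, f₀⟩ := hrefl₀.exists_functional m₀ k₀ hd₀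
  have f₃' := hrefl₀.reflected_apply m₀ k₀ f₁ f₀
  have g₂ := hrefl₁.reflected_apply m₁ k₁ f₀ f₁
  have g₁ : ((2 : ℝ) • s₁ - f) (M₁ - O) = 1 := by
    rw [LinearMap.sub_apply, LinearMap.smul_apply, m₁, f₁, smul_eq_mul]; norm_num
  have h₃ := hrefl₂.reflected_apply m₂ k₂ g₁ g₂
  have h₂ : ((2 : ℝ) • s₂ - ((2 : ℝ) • s₁ - f)) (M₂ - O) = 1 := by
    rw [LinearMap.sub_apply, LinearMap.smul_apply, m₂, g₂, smul_eq_mul]; norm_num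
  have hdual : (2 : ℝ) • s₂ - ((2 : ℝ) • s₁ - f) = (2 : ℝ) • s₃ - ((2 : ℝ) • s₀ - f) := by
    rw [eq_sub_of_add_eq hs]; module
  rw [hdual] at h₂ h₃
  have c₀ : ((2 : ℝ) • s₀ - f) (M₀ - O) = 1 := by
    rw [LinearMap.sub_apply, LinearMap.smul_apply, m₀, f₀, smul_eq_mul]; norm_num
  generalize (2 : ℝ) • s₀ - f = c at *
  have c₃ : c (M₃ - O) = 1 := by
    rw [LinearMap.sub_apply, LinearMap.smul_apply, m₃, smul_eq_mul] at h₃; linarith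
  -- The line reflected at `M₀` is not the side `P₃P₀`, since it meets `P₀P₁` outside `P₀`.
  have hc : c (P₀ - P₃) ≠ 0 := by
    intro hc
    have hd₃ : P₀ - P₃ ≠ 0 := by
      intro h
      rw [sub_eq_zero.mp h, Set.insert_comm, Set.pair_eq_singleton] at h013
      exact h013 (collinear_pair ℝ _ _)
    have hpar : ¬ ∃ t : ℝ, M₃' - O = t • (P₀ - P₃) := by
      rintro ⟨t, ht⟩
      rw [ht, map_smul, k₃, smul_zero] at m₃'
      exact zero_ne_one m₃'
    obtain ⟨x, y, -, -, -, -, hxy⟩ := exists_dual_basis_of_not_parallel hd₃ hpar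
    have hcs : s₃ (M₀ - O) = c (M₀ - O) := by
      rw [hxy (M₀ - O), map_add, map_add, map_smul, map_smul, map_smul, map_smul, hc, k₃, m₃', f₃']
    obtain ⟨t, rfl⟩ := hM₀
    have ht : t ≠ 0 := by
      rintro rfl
      exact hM₀v.1 (by simp)
    have k₃' : s₃ (P₁ - P₀) = 0 := by
      rw [c₀, add_sub_right_comm, map_add, s₃0, map_smul, add_eq_left, smul_eq_zero] at hcs
      exact hcs.resolve_left ht
    have hpar' : ¬ ∃ t : ℝ, P₁ - P₀ = t • (P₀ - P₃) := by
      rintro ⟨r, hr⟩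
      refine h013 ?_
      rw [Set.insert_comm]
      exact collinear_of_mem_lineThrough ⟨-r, by rw [neg_smul, ← smul_neg, neg_sub, ← hr]; abel⟩
    obtain ⟨x', y', -, -, -, -, hxy'⟩ := exists_dual_basis_of_not_parallel hd₃ hpar'
    rw [hxy' (P₃ - O), map_add, map_smul, map_smul, k₃, k₃', smul_zero, smul_zero, add_zero] at s₃3
    exact zero_ne_one s₃3
  have hM : M₃ = M₃' := by
    have hse : s₃ (P₀ - O) ≠ 0 := by rw [s₃0]; exact one_ne_zero
    have := eq_of_functionals k₃ hc hse (m₃.trans m₃'.symm) (c₃.trans f₃'.symm)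
    exact sub_left_injective this
  refine ⟨hM, harmonicLines_of_reflected_apply m₃ k₃ ?_ h₂ h₃ ?_ ?_ ?_⟩
  · rw [LinearMap.sub_apply, LinearMap.smul_apply, k₃, smul_zero, zero_sub]
    exact neg_ne_zero.mpr hc
  · rw [sub_sub_cancel, c₀]
  · rintro rfl
    exact hnpar23 ⟨0, by simp⟩
  · rintro rfl
    exact hnpar03 ⟨0, by simp [hM]⟩
end

section
/- Let n = 2k with k ≥ 2 an integer, and let P_j = (cos(2πj/n), sin(2πj/n)) for j ∈ ℤ (the vertices of a regular n-gon inscribed in the unit circle, so P_{j+n} = P_j), with center O = 0. Let (M_j)_{j∈ℤ} be a sequence of points of ℝ² such that for every j ∈ ℤ, M_j lies on the line P_jP_{j+1} and the quadruple of lines through M_j, (M_{j−1}M_j, M_jM_{j+1}; M_jO, P_jP_{j+1}), is harmonic. Assume moreover that no line M_jM_{j+1} is parallel to any great diagonal line P_mP_{m+k} (the line ℝ·P_m through the center). Then M_{j+n} = M_j for every j ∈ ℤ; that is, every orbit of the centrally-projective regular n-gon CPol(O; P₀,…,P_{n−1}) is n-periodic, so this billiard is n-reflective. -/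
/-- The determinant of two vectors of `ℝ²`. -/
def planeCross (u v : ℝ × ℝ) : ℝ := u.1 * v.2 - u.2 * v.1

/-- The direction vector of the line `AB`, normalized so that its cross product with
any point of the line is `1`. It is a quarter turn of the polar dual of the line. -/
noncomputable def dualVector (A B : ℝ × ℝ) : ℝ × ℝ := (planeCross A B)⁻¹ • (B - A)

/-- In dual coordinates, the projective reflection is the central symmetry about the dual
of the side; moreover the reflected line is transverse to the side. -/
lemma HarmonicLines.dualVector_add {A M B e : ℝ × ℝ} (hM : planeCross M e ≠ 0)
    (h : HarmonicLines (A - M) (B - M) ((0 : ℝ × ℝ) - M) e) :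
    dualVector A M + dualVector M B = (2 * (planeCross M e)⁻¹) • e ∧
      planeCross M (dualVector A M) = 1 ∧ planeCross (dualVector A M) e ≠ 0 := by
  obtain ⟨a, b, ha, hb, ⟨s, hs, h₁⟩, t, ht, h₂⟩ := h
  have hA : A = M + s • (a • ((0 : ℝ × ℝ) - M) + b • e) := by rw [← h₁]; abel
  have hB : B = M + t • (a • ((0 : ℝ × ℝ) - M) - b • e) := by rw [← h₂]; abel
  have hAM : planeCross A M = -(s * b * planeCross M e) := by
    rw [hA]; simp [planeCross]; ring
  have hMB : planeCross M B = -(t * b * planeCross M e) := by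
    rw [hB]; simp [planeCross]; ring
  have hdA : dualVector A M = (planeCross M e)⁻¹ • (e - (a / b) • M) := by
    rw [dualVector, hAM, hA]
    ext <;> simp <;> field_simp <;> ring
  have hdB : dualVector M B = (planeCross M e)⁻¹ • (e + (a / b) • M) := by
    rw [dualVector, hMB, hB]
    ext <;> simp <;> field_simp <;> ring
  refine ⟨?_, ?_, ?_⟩
  · rw [hdA, hdB]; module
  · have : planeCross M (dualVector A M) = (planeCross M e)⁻¹ * planeCross M e := by
      rw [hdA]; simp only [planeCross, Prod.smul_fst, Prod.smul_snd, Prod.fst_sub, Prod.snd_sub,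
        smul_eq_mul]; ring
    rw [this, inv_mul_cancel₀ hM]
  · have : planeCross (dualVector A M) e = -(a / b) * ((planeCross M e)⁻¹ * planeCross M e) := by
      rw [hdA]; simp only [planeCross, Prod.smul_fst, Prod.smul_snd, Prod.fst_sub, Prod.snd_sub,
        smul_eq_mul]; ring
    rw [this, inv_mul_cancel₀ hM, mul_one]
    exact neg_ne_zero.mpr (div_ne_zero ha hb)

/-- A point is determined by its cross products with two independent vectors. -/
lemma eq_of_planeCross_eq {u v x y : ℝ × ℝ} (huv : planeCross u v ≠ 0)
    (hu : planeCross x u = planeCross y u) (hv : planeCross x v = planeCross y v) : x = y := by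
  simp only [planeCross] at *
  ext
  · apply mul_left_cancel₀ huv
    linear_combination u.1 * hv - v.1 * hu
  · apply mul_left_cancel₀ huv
    linear_combination u.2 * hv - v.2 * hu

/-- Two solutions of `f (j - 1) + f j = q j` differ by a sequence of period `2`. -/
lemma periodic_of_add_eq {E : Type*} [AddCommGroup E] {f h q : ℤ → E} (k : ℕ)
    (hf : ∀ j, f (j - 1) + f j = q j) (hh : ∀ j, h (j - 1) + h j = q j)
    (hper : ∀ j, h (j + 2 * k) = h j) (j : ℤ) : f (j + 2 * k) = f j := by
  have key : ∀ j, f j - h j = -(f (j - 1) - h (j - 1)) := fun j => by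
    rw [eq_sub_of_add_eq' (hf j), eq_sub_of_add_eq' (hh j)]; abel
  have hp : Function.Periodic (fun j => f j - h j) (2 : ℤ) := fun j => by
    have h₁ := key (j + 2)
    have h₂ := key (j + 1)
    rw [show j + 2 - 1 = j + 1 by ring] at h₁
    rw [show j + 1 - 1 = j by ring] at h₂
    simp only [h₁, h₂, neg_neg]
  have := hp.nat_mul k j
  simp only [mul_comm (k : ℤ), hper] at this
  exact sub_left_injective this

/-- The centrally-projective regular `n`-gon (`n = 2k` even, center `O = 0`) is
`n`-reflective: every orbit `(M_j)` avoiding directions of the great diagonals is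
`n`-periodic. -/
theorem centrallyProjective_regular_polygon_n_reflective
    (k : ℕ) (hk : 2 ≤ k) (n : ℕ) (hn : n = 2 * k)
    (P : ℤ → ℝ × ℝ)
    (hP : ∀ j : ℤ, P j =
      (Real.cos (2 * Real.pi * (j : ℝ) / (n : ℝ)), Real.sin (2 * Real.pi * (j : ℝ) / (n : ℝ))))
    (M : ℤ → ℝ × ℝ)
    (hside : ∀ j : ℤ, M j ∈ lineThrough (P j) (P (j + 1)))
    (hrefl : ∀ j : ℤ, HarmonicLines (M (j - 1) - M j) (M (j + 1) - M j)
      ((0 : ℝ × ℝ) - M j) (P (j + 1) - P j))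
    (hnpar : ∀ j m : ℤ, ¬ ∃ t : ℝ, M (j + 1) - M j = t • P m) :
    ∀ j : ℤ, M (j + (n : ℤ)) = M j := by
  subst hn
  have hk0 : (0 : ℝ) < k := by positivity
  have hk2 : (2 : ℝ) ≤ k := by exact_mod_cast hk
  set θ : ℝ := Real.pi / k with hθ
  have hP' : ∀ j : ℤ, P j = (Real.cos (j * θ), Real.sin (j * θ)) := fun j => by
    rw [hP, show 2 * Real.pi * (j : ℝ) / ((2 * k : ℕ) : ℝ) = j * θ by
      rw [hθ]; push_cast; field_simp]
  have hθ0 : 0 < θ := by positivity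
  have hθ2 : θ ≤ Real.pi / 2 := by
    rw [hθ]; gcongr
  have hsin : 0 < Real.sin θ := Real.sin_pos_of_pos_of_lt_pi hθ0 (by linarith [Real.pi_pos])
  have hcos : 0 ≤ Real.cos θ := Real.cos_nonneg_of_neg_pi_div_two_le_of_le (by linarith) hθ2
  have hPsucc : ∀ j : ℤ, P (j + 1) + P (j - 1) = (2 * Real.cos θ) • P j := fun j => by
    simp only [hP']
    push_cast
    rw [add_mul, sub_mul, one_mul]
    ext
    · simp [Real.cos_add, Real.cos_sub]; ring
    · simp [Real.sin_add, Real.sin_sub]; ring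
  have hPper : ∀ j : ℤ, P (j + 2 * k) = P j := fun j => by
    have : ((j + 2 * k : ℤ) : ℝ) * θ = j * θ + 2 * Real.pi := by
      rw [hθ]; push_cast; field_simp
    rw [hP', hP', this, Real.cos_add_two_pi, Real.sin_add_two_pi]
  have hcross : ∀ j : ℤ, planeCross (M j) (P (j + 1) - P j) = Real.sin θ := fun j => by
    obtain ⟨t, ht⟩ := hside j
    have : planeCross (M j) (P (j + 1) - P j) = planeCross (P j) (P (j + 1)) := by
      rw [ht]; simp [planeCross]; ring
    rw [this, hP', hP']
    push_cast
    rw [add_mul, one_mul, Real.cos_add, Real.sin_add, planeCross]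
    linear_combination Real.sin θ * Real.sin_sq_add_cos_sq (j * θ)
  have hdual := fun j => (hrefl j).dualVector_add (by rw [hcross]; exact hsin.ne')
  simp only [hcross] at hdual
  have hfper : ∀ j : ℤ, dualVector (M (j + 2 * k)) (M (j + 2 * k + 1)) =
      dualVector (M j) (M (j + 1)) := by
    refine periodic_of_add_eq (f := fun j => dualVector (M j) (M (j + 1)))
      (h := fun j => ((Real.sin θ)⁻¹ / (1 + Real.cos θ)) • (P (j + 2) - P j))
      (q := fun j => (2 * (Real.sin θ)⁻¹) • (P (j + 1) - P j)) k
      (fun j => ?_) (fun j => ?_) (fun j => ?_)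
    · simpa using (hdual j).1
    · have h₁ := eq_sub_of_add_eq (hPsucc (j + 1))
      have h₂ := eq_sub_of_add_eq' (hPsucc j)
      rw [show j + 1 + 1 = j + 2 by ring, show j + 1 - 1 = j by ring] at h₁
      rw [show j - 1 + 2 = j + 1 by ring, h₁, h₂]
      have hc : 1 + Real.cos θ ≠ 0 := by positivity
      rw [show (2 * (Real.sin θ)⁻¹) =
        ((Real.sin θ)⁻¹ / (1 + Real.cos θ)) * (2 * (1 + Real.cos θ)) by field_simp]
      module
    · simp only [show j + 2 * (k : ℤ) + 2 = j + 2 + 2 * k by ring, hPper]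
  intro j
  push_cast
  have hprev := hfper (j - 1)
  rw [show j - 1 + 2 * (k : ℤ) = j + 2 * k - 1 by ring, sub_add_cancel, sub_add_cancel] at hprev
  have hside_per := hcross (j + 2 * k)
  rw [show j + 2 * (k : ℤ) + 1 = j + 1 + 2 * k by ring, hPper, hPper] at hside_per
  refine eq_of_planeCross_eq (hdual j).2.2 ?_ (hside_per.trans (hcross j).symm)
  rw [(hdual j).2.1, ← hprev, (hdual (j + 2 * k)).2.1]
end

section
/- Let n ≥ 3 be an odd integer and P₀,…,P_{n−1} points of ℝ² (indices taken mod n) such that no three consecutive vertices P_{j−1}, P_j, P_{j+1} are collinear, and let O ∈ ℝ² be a point lying on none of the edge lines P_jP_{j+1}. Let (M_j)_{j∈ℤ} be a sequence of points such that for every j ∈ ℤ, M_j lies on the line P_jP_{j+1} (indices of P mod n) and the quadruple of lines through M_j, (M_{j−1}M_j, M_jM_{j+1}; M_jO, P_jP_{j+1}), is harmonic. Then M_{j+2n} = M_j for every j ∈ ℤ; that is, every orbit of the centrally-projective polygon CPol(O; P₀,…,P_{n−1}) is 2n-periodic, so this billiard is 2n-reflective. -/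
/-- The pairing of a covector with a vector of `ℝ²`. -/
def pairing (c X : ℝ × ℝ) : ℝ := c.1 * X.1 + c.2 * X.2

/-- The determinant of two vectors of `ℝ²`. -/
def cross (u v : ℝ × ℝ) : ℝ := u.1 * v.2 - u.2 * v.1

/-- The covector taking the value `1` at `A` and `B`, when `A` and `B` are independent. -/
noncomputable def lineCovector (A B : ℝ × ℝ) : ℝ × ℝ :=
  ((B.2 - A.2) / cross A B, (A.1 - B.1) / cross A B)

theorem pairing_lineCovector_left {A B : ℝ × ℝ} (h : cross A B ≠ 0) :
    pairing (lineCovector A B) A = 1 := by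
  simp only [pairing, lineCovector]
  field_simp
  simp only [cross]
  ring

theorem pairing_lineCovector_right {A B : ℝ × ℝ} (h : cross A B ≠ 0) :
    pairing (lineCovector A B) B = 1 := by
  simp only [pairing, lineCovector]
  field_simp
  simp only [cross]
  ring

/-- A covector is determined by its values on two independent vectors. -/
theorem eq_of_pairing_eq {u v c d : ℝ × ℝ} (h : cross u v ≠ 0)
    (hu : pairing c u = pairing d u) (hv : pairing c v = pairing d v) : c = d := by
  simp only [pairing, cross] at *
  ext
  · refine mul_right_cancel₀ h ?_
    linear_combination v.2 * hu - u.2 * hv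
  · refine mul_right_cancel₀ h ?_
    linear_combination u.1 * hv - v.1 * hu

theorem pairing_comm (c X : ℝ × ℝ) : pairing c X = pairing X c := by
  simp only [pairing]
  ring

theorem cross_mul_cross (c d u v : ℝ × ℝ) :
    cross c d * cross u v = pairing c u * pairing d v - pairing c v * pairing d u := by
  simp only [pairing, cross]
  ring

/-- The reflection law at a point `m` of a line with covector `c` and direction `D`: the covectors
of the incoming line `um` and of the outgoing line `mv` have sum `2c`, and are independent. -/
theorem HarmonicLines.lineCovector_add {u m v D c : ℝ × ℝ}
    (h : HarmonicLines (u - m) (v - m) (-m) D) (hmD : cross m D ≠ 0)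
    (hm : pairing c m = 1) (hD : pairing c D = 0) :
    lineCovector u m + lineCovector m v = (2 : ℝ) • c ∧
      cross (lineCovector u m) (lineCovector m v) ≠ 0 ∧
      pairing (lineCovector u m) m = 1 ∧ pairing (lineCovector m v) m = 1 := by
  obtain ⟨a, b, ha, hb, ⟨s, hs, hu⟩, t, ht, hv⟩ := h
  have eu : u = m + s • (a • (-m) + b • D) := by rw [← hu]; abel
  have ev : v = m + t • (a • (-m) - b • D) := by rw [← hv]; abel
  have hum : cross u m ≠ 0 := by
    have : cross u m = -(s * b) * cross m D := by
      rw [eu]; simp [cross]; ring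
    rw [this]
    exact mul_ne_zero (neg_ne_zero.2 (mul_ne_zero hs hb)) hmD
  have hmv : cross m v ≠ 0 := by
    have : cross m v = -(t * b) * cross m D := by
      rw [ev]; simp [cross]; ring
    rw [this]
    exact mul_ne_zero (neg_ne_zero.2 (mul_ne_zero ht hb)) hmD
  have h₁ := pairing_lineCovector_right hum
  have h₂ := pairing_lineCovector_left hmv
  have h₁u := pairing_lineCovector_left hum
  have h₂v := pairing_lineCovector_right hmv
  set β := lineCovector u m
  set γ := lineCovector m v
  have k₁ : b * pairing β D = a := by
    refine mul_left_cancel₀ hs ?_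
    rw [eu] at h₁u
    simp only [pairing, Prod.fst_add, Prod.snd_add, Prod.fst_neg,
      Prod.snd_neg, Prod.smul_fst, Prod.smul_snd, smul_eq_mul] at *
    linear_combination h₁u - (1 - s * a) * h₁
  have k₂ : b * pairing γ D = -a := by
    refine mul_left_cancel₀ ht ?_
    rw [ev] at h₂v
    simp only [pairing, Prod.fst_add, Prod.snd_add, Prod.fst_sub, Prod.snd_sub, Prod.fst_neg,
      Prod.snd_neg, Prod.smul_fst, Prod.smul_snd, smul_eq_mul] at *
    linear_combination (1 - t * a) * h₂ - h₂v
  refine ⟨eq_of_pairing_eq hmD ?_ ?_, fun h0 => ?_, h₁, h₂⟩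
  · simp only [pairing, Prod.fst_add, Prod.snd_add,
      Prod.smul_fst, Prod.smul_snd, smul_eq_mul] at *
    linear_combination h₁ + h₂ - 2 * hm
  · refine mul_left_cancel₀ hb ?_
    simp only [pairing, Prod.fst_add, Prod.snd_add,
      Prod.smul_fst, Prod.smul_snd, smul_eq_mul] at *
    linear_combination k₁ + k₂ - 2 * b * hD
  · have h3 := cross_mul_cross β γ m D
    rw [h0, h₁, h₂] at h3
    apply ha
    linear_combination (b / 2) * h3 - k₁ / 2 + k₂ / 2

theorem cross_sub_ne_zero {A B O : ℝ × ℝ} (hAB : A ≠ B) (hO : O ∉ lineThrough A B) :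
    cross (A - O) (B - O) ≠ 0 := by
  intro h
  apply hO
  simp only [cross, Prod.fst_sub, Prod.snd_sub] at h
  by_cases h1 : B.1 - A.1 = 0
  · have h2 : B.2 - A.2 ≠ 0 := fun h2 =>
      hAB (Prod.ext (sub_eq_zero.1 h1).symm (sub_eq_zero.1 h2).symm)
    refine ⟨(O.2 - A.2) / (B.2 - A.2), Prod.ext ?_ ?_⟩
    · simp only [Prod.fst_add, Prod.smul_fst, Prod.fst_sub, smul_eq_mul]
      field_simp
      linear_combination -h
    · simp only [Prod.snd_add, Prod.smul_snd, Prod.snd_sub, smul_eq_mul]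
      field_simp
      ring
  · refine ⟨(O.1 - A.1) / (B.1 - A.1), Prod.ext ?_ ?_⟩
    · simp only [Prod.fst_add, Prod.smul_fst, Prod.fst_sub, smul_eq_mul]
      field_simp
      ring
    · simp only [Prod.snd_add, Prod.smul_snd, Prod.snd_sub, smul_eq_mul]
      field_simp
      linear_combination h

/-- If `β j + β (j + 1)` is periodic with odd period `n`, then `β` has period `2n`. -/
theorem periodic_two_mul_of_add_succ_periodic {E : Type*} [AddCommGroup E] {n : ℕ} (hodd : Odd n)
    {β : ℤ → E} (h : ∀ j, β (j + n) + β (j + n + 1) = β j + β (j + 1)) (j : ℤ) :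
    β (j + 2 * n) = β j := by
  have step : ∀ k : ℕ, β (j + k + n) - β (j + k) = (-1 : ℤ) ^ k • (β (j + n) - β j) := by
    intro k
    induction k with
    | zero => simp
    | succ k ih =>
      have e := h (j + k)
      have e1 : j + ((k + 1 : ℕ) : ℤ) + n = j + k + n + 1 := by push_cast; ring
      have e2 : j + ((k + 1 : ℕ) : ℤ) = j + k + 1 := by push_cast; ring
      rw [e1, e2, pow_succ, mul_neg_one, neg_smul, ← ih, eq_sub_of_add_eq' e]
      abel
  have e := step n
  rw [hodd.neg_one_pow, neg_one_smul, neg_sub, add_assoc, ← two_mul] at e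
  exact sub_left_injective e

/-- For `n ≥ 3` odd, the centrally-projective polygon `CPol(O; P₀,…,P_{n-1})` is
`2n`-reflective: every orbit `(M_j)` is `2n`-periodic. -/
theorem centrallyProjective_polygon_two_n_reflective
    (n : ℕ) (hn : 3 ≤ n) (hodd : Odd n)
    (P : ℤ → ℝ × ℝ) (hper : ∀ j : ℤ, P (j + (n : ℤ)) = P j)
    (hcons : ∀ j : ℤ, ¬ Collinear ℝ {P (j - 1), P j, P (j + 1)})
    (O : ℝ × ℝ) (hO : ∀ j : ℤ, O ∉ lineThrough (P j) (P (j + 1)))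
    (M : ℤ → ℝ × ℝ)
    (hside : ∀ j : ℤ, M j ∈ lineThrough (P j) (P (j + 1)))
    (hrefl : ∀ j : ℤ, HarmonicLines (M (j - 1) - M j) (M (j + 1) - M j)
      (O - M j) (P (j + 1) - P j)) :
    ∀ j : ℤ, M (j + 2 * (n : ℤ)) = M j := by
  have hne : ∀ j, P j ≠ P (j + 1) := fun j h => hcons j (by
    rw [← h, Set.pair_eq_singleton]
    exact collinear_pair ℝ _ _)
  have hcr : ∀ j, cross (P j - O) (P (j + 1) - O) ≠ 0 := fun j =>
    cross_sub_ne_zero (hne j) (hO j)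
  let α : ℤ → ℝ × ℝ := fun j => lineCovector (P j - O) (P (j + 1) - O)
  let β : ℤ → ℝ × ℝ := fun j => lineCovector (M (j - 1) - O) (M j - O)
  have key : ∀ j, β j + β (j + 1) = (2 : ℝ) • α j ∧ cross (β j) (β (j + 1)) ≠ 0 ∧
      pairing (β j) (M j - O) = 1 ∧ pairing (β (j + 1)) (M j - O) = 1 := by
    intro j
    obtain ⟨t, ht⟩ := hside j
    have hl : pairing (α j) (P j - O) = 1 := pairing_lineCovector_left (hcr j)
    have hr : pairing (α j) (P (j + 1) - O) = 1 := pairing_lineCovector_right (hcr j)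
    have hD : pairing (α j) (P (j + 1) - P j) = 0 := by
      simp only [pairing, Prod.fst_sub, Prod.snd_sub] at *
      linear_combination hr - hl
    have hm : pairing (α j) (M j - O) = 1 := by
      rw [ht]
      simp only [pairing, Prod.fst_add, Prod.snd_add, Prod.fst_sub, Prod.snd_sub,
      Prod.smul_fst, Prod.smul_snd, smul_eq_mul] at *
      linear_combination hl + t * hD
    have hmD : cross (M j - O) (P (j + 1) - P j) ≠ 0 := by
      have : cross (M j - O) (P (j + 1) - P j) = cross (P j - O) (P (j + 1) - O) := by
        rw [ht]
        simp [cross]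
        ring
      rw [this]
      exact hcr j
    have hH : HarmonicLines (M (j - 1) - O - (M j - O)) (M (j + 1) - O - (M j - O))
        (-(M j - O)) (P (j + 1) - P j) := by
      simpa only [sub_sub_sub_cancel_right, neg_sub] using hrefl j
    simpa only [β, add_sub_cancel_right] using hH.lineCovector_add hmD hm hD
  have hα : ∀ j, α (j + n) = α j := fun j => by
    simp only [α, hper, add_right_comm j (n : ℤ) 1]
  have hβ : ∀ j, β (j + 2 * n) = β j :=
    periodic_two_mul_of_add_succ_periodic hodd fun j => by
      rw [(key j).1, (key (j + n)).1, hα]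
  intro j
  obtain ⟨-, hc, h₁, h₂⟩ := key j
  obtain ⟨-, -, h₃, h₄⟩ := key (j + 2 * n)
  rw [hβ] at h₃
  rw [add_right_comm, hβ] at h₄
  refine sub_left_injective (b := O) (eq_of_pairing_eq hc ?_ ?_)
  · rw [pairing_comm, h₃, pairing_comm, h₁]
  · rw [pairing_comm, h₄, pairing_comm, h₂]
end

section
/- In ℝ², let h ≠ 0, let γ = {(x, 0) : x ∈ ℝ} and γ' = {(x, h) : x ∈ ℝ} be two parallel horizontal lines, and set P₁ = (0,0) ∈ γ and P₂ = (0,h) ∈ γ'. Equip γ with the transverse line M ↦ MP₂ at each M ∈ γ and γ' with the transverse line M' ↦ M'P₁ at each M' ∈ γ'. Let A₀, A₁, A₂ ∈ γ and B₀, B₁ ∈ γ' be points such that: the quadruple of lines through B₀, (A₀B₀, B₀A₁; B₀P₁, γ'), is harmonic; the quadruple of lines through A₁, (B₀A₁, A₁B₁; A₁P₂, γ), is harmonic; and the quadruple of lines through B₁, (A₁B₁, B₁A₂; B₁P₁, γ'), is harmonic. Then A₂ = A₀ and the quadruple of lines through A₀, (B₁A₀, A₀B₀; A₀P₂, γ),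 is harmonic. Hence (A₀, B₀, A₁, B₁) is a 4-periodic orbit: the converging-mirrors projective billiard is 4-reflective. -/
/-- When the first three directions have the same nonzero height and the fourth is horizontal,
harmonicity says that the third horizontal coordinate is the midpoint of the first two,
and that these are distinct. -/
theorem harmonicLines_horizontal_iff {x y z k : ℝ} (hk : k ≠ 0) :
    HarmonicLines (x, k) (y, k) (z, k) (1, 0) ↔ x + y = 2 * z ∧ x ≠ z := by
  constructor
  · rintro ⟨a, b, ha, hb, ⟨s, hs, h₁⟩, ⟨t, ht, h₂⟩⟩
    simp only [Prod.smul_mk, Prod.mk_add_mk, Prod.mk_sub_mk, smul_eq_mul, Prod.mk.injEq,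
      mul_one, mul_zero, add_zero, sub_zero] at h₁ h₂
    obtain ⟨hx, hsk⟩ := h₁
    obtain ⟨hy, htk⟩ := h₂
    have hsa : s * a = 1 := mul_right_cancel₀ hk (by linear_combination -hsk)
    have hta : t * a = 1 := mul_right_cancel₀ hk (by linear_combination -htk)
    have hst : s = t := mul_right_cancel₀ ha (hsa.trans hta.symm)
    subst hst
    refine ⟨by linear_combination hx + hy + 2 * z * hsa, fun hxz => mul_ne_zero hs hb ?_⟩
    linear_combination hxz - hx - z * hsa
  · rintro ⟨hsum, hne⟩
    refine ⟨1, x - z, one_ne_zero, sub_ne_zero.mpr hne, ⟨1, one_ne_zero, ?_⟩,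
      ⟨1, one_ne_zero, ?_⟩⟩
    · simp
    · simp only [one_smul, Prod.smul_mk, Prod.mk_sub_mk, smul_eq_mul, mul_one, mul_zero,
        sub_zero, Prod.mk.injEq, and_true]
      linear_combination hsum

/-- The converging-mirrors projective billiard is 4-reflective: with mirrors the two
horizontal lines `y = 0` and `y = h`, transverse lines through `P₂ = (0,h)` on the first
and through `P₁ = (0,0)` on the second, three successive projective reflections of a
line close up into a 4-periodic orbit `(A₀, B₀, A₁, B₁)`. -/
theorem converging_mirrors_four_reflective
    (h : ℝ) (hh : h ≠ 0)
    (A₀ A₁ A₂ B₀ B₁ : ℝ × ℝ)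
    (hA₀ : A₀.2 = 0) (hA₁ : A₁.2 = 0) (hA₂ : A₂.2 = 0)
    (hB₀ : B₀.2 = h) (hB₁ : B₁.2 = h)
    (hreflB₀ : HarmonicLines (A₀ - B₀) (A₁ - B₀) (((0, 0) : ℝ × ℝ) - B₀) ((1, 0) : ℝ × ℝ))
    (hreflA₁ : HarmonicLines (B₀ - A₁) (B₁ - A₁) (((0, h) : ℝ × ℝ) - A₁) ((1, 0) : ℝ × ℝ))
    (hreflB₁ : HarmonicLines (A₁ - B₁) (A₂ - B₁) (((0, 0) : ℝ × ℝ) - B₁) ((1, 0) : ℝ × ℝ)) :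
    A₂ = A₀ ∧
      HarmonicLines (B₁ - A₀) (B₀ - A₀) (((0, h) : ℝ × ℝ) - A₀) ((1, 0) : ℝ × ℝ) := by
  obtain ⟨a₀, _⟩ := A₀
  obtain ⟨a₁, _⟩ := A₁
  obtain ⟨a₂, _⟩ := A₂
  obtain ⟨b₀, _⟩ := B₀
  obtain ⟨b₁, _⟩ := B₁
  dsimp only at hA₀ hA₁ hA₂ hB₀ hB₁
  subst hA₀ hA₁ hA₂ hB₀ hB₁
  simp only [Prod.mk_sub_mk, sub_zero, zero_sub, harmonicLines_horizontal_iff hh,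
    harmonicLines_horizontal_iff (neg_ne_zero.mpr hh)] at hreflB₀ hreflA₁ hreflB₁ ⊢
  obtain ⟨hB₀, -⟩ := hreflB₀
  obtain ⟨hA₁, hne⟩ := hreflA₁
  obtain ⟨hB₁, -⟩ := hreflB₁
  refine ⟨Prod.ext (by dsimp only; linarith) rfl, by linarith, fun heq => hne ?_⟩
  linarith
end

section
/- Let P₀, P₁, P₂ be affinely independent points of ℝ². Let M₀ be a point of the line P₀P₁ with M₀ ∉ {P₀, P₁}, and M₁ a point of the line P₁P₂ with M₁ ∉ {P₁, P₂}, such that M₀ ≠ M₁ and the line M₀M₁ contains none of P₀, P₁, P₂. Let M₂ be a point of the line P₂P₀ such that the quadruple of lines through M₁, (M₀M₁, M₁M₂; M₁P₀, P₁P₂), is harmonic, and let M₂' be a point of the line P₂P₀ such that the quadruple of lines through M₀, (M₀M₁, M₀M₂'; M₀P₂, P₀P₁), is harmonic. Then M₂ = M₂'; that is, reflecting the line M₀M₁ at M₁ and reflecting it at M₀ produce lines meeting the third side P₂P₀ at the same point. -/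
/-- The edge vectors at a vertex of a nondegenerate triangle are linearly independent. -/
lemma AffineIndependent.linearIndependent_edges {P₀ P₁ P₂ : ℝ × ℝ}
    (hind : AffineIndependent ℝ ![P₀, P₁, P₂]) :
    LinearIndependent ℝ ![P₀ - P₁, P₂ - P₁] := by
  rw [LinearIndependent.pair_iff]
  intro α β h
  rw [affineIndependent_iff] at hind
  have hw := hind Finset.univ ![α, -α - β, β] (by
    simp [Fin.sum_univ_three]; ring) (by
    rw [← h]
    simp only [Fin.sum_univ_three, Matrix.cons_val]
    module)
  exact ⟨by simpa using hw 0 (Finset.mem_univ _), by simpa using hw 2 (Finset.mem_univ _)⟩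

lemma HarmonicLines.neg_right {d₁ d₂ d₃ d₄ : ℝ × ℝ} (h : HarmonicLines d₁ d₂ d₃ d₄) :
    HarmonicLines d₁ d₂ d₃ (-d₄) := by
  obtain ⟨a, b, ha, hb, ⟨s, hs, h₁⟩, t, ht, h₂⟩ := h
  exact ⟨a, -b, ha, neg_ne_zero.mpr hb, ⟨s, hs, by rw [h₁]; module⟩, t, ht, by rw [h₂]; module⟩

/-- In the affine frame `(u, v)` at a vertex of the triangle, the line joining `m • u` to `n • v`
is reflected at `n • v` to a line through the point `r • u + (1 - r) • v` of the opposite side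
only if the coordinates satisfy the stated relation. -/
lemma HarmonicLines.coordinate_relation {u v : ℝ × ℝ} (huv : LinearIndependent ℝ ![u, v])
    {m n r : ℝ}
    (h : HarmonicLines (m • u - n • v) (r • u + (1 - r) • v - n • v) (u - n • v) v) :
    r * n * (m - 1) + m * (1 - r) * (1 - n) = 0 := by
  obtain ⟨a, b, -, -, ⟨s, -, h₁⟩, t, -, h₂⟩ := h
  rw [LinearIndependent.pair_iff] at huv
  obtain ⟨hm, hn⟩ := huv (m - s * a) (s * (a * n - b) - n) (by
    rw [← sub_eq_zero] at h₁
    rw [← h₁]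
    module)
  obtain ⟨hr, hr'⟩ := huv (r - t * a) (1 - r - n + t * (a * n + b)) (by
    rw [← sub_eq_zero] at h₂
    rw [← h₂]
    module)
  grind

/-- In the right-spherical billiard `S(P₀,P₁,P₂)`, reflecting the line `M₀M₁` at `M₁`
and reflecting it at `M₀` produce lines meeting the third side `P₂P₀` at the same point. -/
theorem rightSpherical_reflections_meet
    (P₀ P₁ P₂ M₀ M₁ M₂ M₂' : ℝ × ℝ)
    (hind : AffineIndependent ℝ ![P₀, P₁, P₂])
    (hM₀ : M₀ ∈ lineThrough P₀ P₁) (hM₀0 : M₀ ≠ P₀) (hM₀1 : M₀ ≠ P₁)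
    (hM₁ : M₁ ∈ lineThrough P₁ P₂) (hM₁1 : M₁ ≠ P₁) (hM₁2 : M₁ ≠ P₂)
    (hMM : M₀ ≠ M₁)
    (h0 : P₀ ∉ lineThrough M₀ M₁) (h1 : P₁ ∉ lineThrough M₀ M₁)
    (h2 : P₂ ∉ lineThrough M₀ M₁)
    (hM₂ : M₂ ∈ lineThrough P₂ P₀)
    (hrefl₁ : HarmonicLines (M₀ - M₁) (M₂ - M₁) (P₀ - M₁) (P₂ - P₁))
    (hM₂' : M₂' ∈ lineThrough P₂ P₀)
    (hrefl₀ : HarmonicLines (M₁ - M₀) (M₂' - M₀) (P₂ - M₀) (P₁ - P₀)) :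
    M₂ = M₂' := by
  have huv := hind.linearIndependent_edges
  obtain ⟨x, rfl⟩ := hM₀
  obtain ⟨n, rfl⟩ := hM₁
  obtain ⟨r, rfl⟩ := hM₂
  obtain ⟨r', rfl⟩ := hM₂'
  have hx : 1 - x ≠ 0 := by
    intro hx
    apply hM₀1
    rw [show x = 1 by linarith]
    module
  have hn : 1 - n ≠ 0 := by
    intro hn
    apply hM₁2
    rw [show n = 1 by linarith]
    module
  have e₁ : r * n * ((1 - x) - 1) + (1 - x) * (1 - r) * (1 - n) = 0 := by
    apply HarmonicLines.coordinate_relation huv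
    convert hrefl₁ using 1 <;> module
  have e₀ : (1 - r') * (1 - x) * (n - 1) + n * (1 - (1 - r')) * (1 - (1 - x)) = 0 := by
    apply HarmonicLines.coordinate_relation (LinearIndependent.pair_symm_iff.mp huv)
    convert hrefl₀.neg_right using 1 <;> module
  have hmul : (r - r') * ((1 - x) * (1 - n)) = 0 := by
    linear_combination (-r') * e₁ - r * e₀
  have hr : r = r' :=
    sub_eq_zero.mp ((mul_eq_zero.mp hmul).resolve_right (mul_ne_zero hx hn))
  rw [hr]
end

section
/- Let n = 2k with k ≥ 2 an integer, and let P_j = (cos(2πj/n), sin(2πj/n)) for j ∈ ℤ (the vertices of a regular n-gon inscribed in the unit circle, so P_{j+n} = P_j), with center O = 0. Let (M_j)_{j∈ℤ} be a sequence of points of ℝ² such that for every j ∈ ℤ, M_j lies on the line P_jP_{j+1} and the quadruple of lines through M_j, (M_{j−1}M_j, M_jM_{j+1}; M_jO, P_jP_{j+1}), is harmonic. Fix m ∈ ℤ and an integer r ≥ 0, let L_m = ℝ·P_m be the great diagonal line through P_m and P_{m+k} = −P_m, and assume that no line M_jM_{j+1} with m − r − 2 ≤ j ≤ m + r is parallel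 to L_m. Then the lines M_{m−r−2}M_{m−r−1} and M_{m+r}M_{m+r+1} intersect L_m at the same point. -/
/-- The line of `ℝ²` through the point `p` with direction vector `d`, as a set of points. -/
def lineDir (p d : ℝ × ℝ) : Set (ℝ × ℝ) :=
  {X | ∃ t : ℝ, X = p + t • d}

/-- The determinant of two vectors of the plane. -/
def planeDet (u v : ℝ × ℝ) : ℝ := u.1 * v.2 - u.2 * v.1

/-- The value at `Q` of the linear form equal to `1` on the line `AB`. -/
noncomputable def lineForm (A B Q : ℝ × ℝ) : ℝ := planeDet Q (B - A) / planeDet A (B - A)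

theorem planeDet_ne_zero_of_not_parallel {Q d : ℝ × ℝ} (hQ : Q.1 ^ 2 + Q.2 ^ 2 = 1)
    (h : ¬ ∃ t : ℝ, d = t • Q) : planeDet Q d ≠ 0 := by
  intro h0
  unfold planeDet at h0
  refine h ⟨d.1 * Q.1 + d.2 * Q.2, Prod.ext ?_ ?_⟩
  · simp only [Prod.smul_fst, smul_eq_mul]
    linear_combination (-d.1) * hQ - Q.2 * h0
  · simp only [Prod.smul_snd, smul_eq_mul]
    linear_combination (-d.2) * hQ + Q.1 * h0

/-- The line `AB` meets the line `ℝ • Q` at the point where its linear form is `1`. -/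
theorem inv_lineForm_smul_mem_lineThrough {A B Q : ℝ × ℝ} (h : planeDet Q (B - A) ≠ 0) :
    (lineForm A B Q)⁻¹ • Q ∈ lineThrough A B := by
  refine ⟨-planeDet Q A / planeDet Q (B - A), ?_⟩
  rw [lineForm, inv_div]
  apply Prod.ext
  · simp only [Prod.smul_fst, Prod.fst_add, smul_eq_mul]
    field_simp
    simp only [planeDet, Prod.fst_sub, Prod.snd_sub]
    ring
  · simp only [Prod.smul_snd, Prod.snd_add, smul_eq_mul]
    field_simp
    simp only [planeDet, Prod.fst_sub, Prod.snd_sub]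
    ring

/-- The linear forms of the two lines exchanged by the projective reflection at `M`
have mean the linear form of the side. -/
theorem HarmonicLines.lineForm_add {A M B e : ℝ × ℝ}
    (h : HarmonicLines (A - M) (B - M) (0 - M) e) (hM : planeDet M e ≠ 0) (Q : ℝ × ℝ) :
    lineForm A M Q + lineForm M B Q = 2 * planeDet Q e / planeDet M e := by
  obtain ⟨a, b, -, hb, ⟨s, hs, h₁⟩, t, ht, h₂⟩ := h
  have hQ₁ : planeDet Q (M - A) = s * (a * planeDet Q M - b * planeDet Q e) := by
    rw [← neg_sub A M, h₁]; simp [planeDet]; ring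
  have hA : planeDet A (M - A) = -(s * b * planeDet M e) := by
    have : planeDet A (M - A) = -planeDet M (A - M) := by simp [planeDet]; ring
    rw [this, h₁]; simp [planeDet]; ring
  have hQ₂ : planeDet Q (B - M) = -(t * (a * planeDet Q M + b * planeDet Q e)) := by
    rw [h₂]; simp [planeDet]; ring
  have hB : planeDet M (B - M) = -(t * b * planeDet M e) := by
    rw [h₂]; simp [planeDet]; ring
  rw [lineForm, lineForm, hQ₁, hA, hQ₂, hB]
  field_simp
  ring

/-- If the sums of consecutive terms of `h` are symmetric about `m - 1 / 2`,
then `h` is symmetric about `m - 1`. -/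
theorem symmetric_of_consecutive_sums_symmetric {h g : ℤ → ℝ} (m : ℤ)
    (hg : ∀ j, h (j - 1) + h j = g j) (hsymm : ∀ i, g (m + i) = g (m - 1 - i)) (r : ℕ) :
    h (m + r) = h (m - r - 2) := by
  induction r with
  | zero =>
    have h₀ := hg m
    have h₁ := hg (m - 1)
    have h₂ := hsymm 0
    rw [show m - 1 - 1 = m - 2 by ring] at h₁
    simp only [add_zero, sub_zero] at h₂
    simp only [Nat.cast_zero, add_zero, sub_zero]
    linarith
  | succ r ih =>
    have h₀ := hg (m + (r + 1))
    have h₁ := hg (m - r - 2)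
    have h₂ := hsymm (r + 1)
    rw [show m + ((r : ℤ) + 1) - 1 = m + r by ring] at h₀
    rw [show m - 1 - ((r : ℤ) + 1) = m - r - 2 by ring] at h₂
    rw [show m - (r : ℤ) - 2 - 1 = m - (r + 1) - 2 by ring] at h₁
    push_cast
    linarith

/-- In the centrally-projective regular `n`-gon (`n = 2k`), for any `m` and `r ≥ 0`,
the lines `M_{m-r-2}M_{m-r-1}` and `M_{m+r}M_{m+r+1}` of an orbit intersect the great
diagonal `L_m = ℝ • P_m` at the same point. -/
theorem orbit_lines_meet_great_diagonal
    (k : ℕ) (hk : 2 ≤ k) (n : ℕ) (hn : n = 2 * k)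
    (P : ℤ → ℝ × ℝ)
    (hP : ∀ j : ℤ, P j =
      (Real.cos (2 * Real.pi * (j : ℝ) / (n : ℝ)), Real.sin (2 * Real.pi * (j : ℝ) / (n : ℝ))))
    (M : ℤ → ℝ × ℝ)
    (hside : ∀ j : ℤ, M j ∈ lineThrough (P j) (P (j + 1)))
    (hrefl : ∀ j : ℤ, HarmonicLines (M (j - 1) - M j) (M (j + 1) - M j)
      ((0 : ℝ × ℝ) - M j) (P (j + 1) - P j))
    (m : ℤ) (r : ℕ)
    (hnpar : ∀ j : ℤ, m - (r : ℤ) - 2 ≤ j → j ≤ m + (r : ℤ) →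
      ¬ ∃ t : ℝ, M (j + 1) - M j = t • P m) :
    ∃ X : ℝ × ℝ, X ∈ lineThrough (M (m - (r : ℤ) - 2)) (M (m - (r : ℤ) - 1)) ∧
      X ∈ lineThrough (M (m + (r : ℤ))) (M (m + (r : ℤ) + 1)) ∧
      X ∈ lineDir 0 (P m) := by
  set θ : ℝ := 2 * Real.pi / n with hθ
  have hP' : ∀ j : ℤ, P j = (Real.cos (j * θ), Real.sin (j * θ)) := by
    intro j
    rw [hP, hθ, show 2 * Real.pi * (j : ℝ) / n = j * (2 * Real.pi / n) by ring]
  have hdet : ∀ i j : ℤ, planeDet (P i) (P (j + 1) - P j) =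
      Real.sin (((j - i + 1 : ℤ) : ℝ) * θ) - Real.sin (((j - i : ℤ) : ℝ) * θ) := by
    intro i j
    rw [show ((j - i + 1 : ℤ) : ℝ) * θ = ((j + 1 : ℤ) : ℝ) * θ - i * θ by push_cast; ring,
      show ((j - i : ℤ) : ℝ) * θ = (j : ℝ) * θ - i * θ by push_cast; ring,
      Real.sin_sub, Real.sin_sub]
    simp only [hP', planeDet, Prod.fst_sub, Prod.snd_sub]
    ring
  have hsin : Real.sin θ ≠ 0 := by
    have hn4 : (4 : ℝ) ≤ n := by exact_mod_cast (by omega : 4 ≤ n)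
    have hpi := Real.pi_pos
    refine (Real.sin_pos_of_pos_of_lt_pi (by positivity) ?_).ne'
    rw [hθ, div_lt_iff₀ (by linarith)]
    nlinarith
  have hMdet : ∀ j : ℤ, planeDet (M j) (P (j + 1) - P j) = Real.sin θ := by
    intro j
    obtain ⟨t, ht⟩ := hside j
    have hj := hdet j j
    simp only [sub_self, zero_add, Int.cast_one, one_mul, Int.cast_zero, zero_mul,
      Real.sin_zero, sub_zero] at hj
    rw [← hj, ht]
    simp [planeDet]
    ring
  have hsum : ∀ j : ℤ, lineForm (M (j - 1)) (M (j - 1 + 1)) (P m) +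
      lineForm (M j) (M (j + 1)) (P m) =
      2 * planeDet (P m) (P (j + 1) - P j) / Real.sin θ := by
    intro j
    rw [sub_add_cancel, (hrefl j).lineForm_add (by rwa [hMdet]), hMdet]
  have hsymm := symmetric_of_consecutive_sums_symmetric
    (h := fun j => lineForm (M j) (M (j + 1)) (P m)) m hsum (fun i => by
      rw [hdet, hdet, show m - 1 - i - m + 1 = -(m + i - m) by ring,
        show m - 1 - i - m = -(m + i - m + 1) by ring, Int.cast_neg, Int.cast_neg,
        neg_mul, neg_mul, Real.sin_neg, Real.sin_neg]
      ring) r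
  have hunit : (P m).1 ^ 2 + (P m).2 ^ 2 = 1 := by
    rw [hP']
    exact Real.cos_sq_add_sin_sq _
  have hmem : ∀ j : ℤ, m - (r : ℤ) - 2 ≤ j → j ≤ m + (r : ℤ) →
      (lineForm (M j) (M (j + 1)) (P m))⁻¹ • P m ∈ lineThrough (M j) (M (j + 1)) :=
    fun j h₁ h₂ => inv_lineForm_smul_mem_lineThrough
      (planeDet_ne_zero_of_not_parallel hunit (hnpar j h₁ h₂))
  have hleft := hmem (m - r - 2) le_rfl (by omega)
  have hright := hmem (m + r) (by omega) le_rfl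
  rw [← hsymm, show m - (r : ℤ) - 2 + 1 = m - r - 1 by ring] at hleft
  exact ⟨_, hleft, hright, _, (zero_add _).symm⟩
end

section
/- Let p ∈ ℝ² with p ≠ 0, and let ℓ, ℓ', L, T be four lines through p forming a harmonic quadruple (ℓ, ℓ'; L, T), such that L passes through the origin 0 and none of ℓ, ℓ', T passes through 0. Let N = ℓ*, N' = ℓ'* and S = T* be the polar dual points of ℓ, ℓ', T with respect to the origin. Then N, N', S all lie on the dual line p* = {x ∈ ℝ² : ⟨p, x⟩ = 1}, and S = (N + N')/2, i.e. S is the midpoint of the segment joining N and N'. -/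
/-- The standard dot product on `ℝ²`. -/
def dot (u v : ℝ × ℝ) : ℝ := u.1 * v.1 + u.2 * v.2

theorem dot_add_right (u v w : ℝ × ℝ) : dot u (v + w) = dot u v + dot u w := by
  simp only [dot, Prod.fst_add, Prod.snd_add]; ring

theorem dot_smul_right (u v : ℝ × ℝ) (c : ℝ) : dot u (c • v) = c * dot u v := by
  simp only [dot, Prod.smul_fst, Prod.smul_snd, smul_eq_mul]; ring

theorem dot_sub_right (u v w : ℝ × ℝ) : dot u (v - w) = dot u v - dot u w := by
  simp only [dot, Prod.fst_sub, Prod.snd_sub]; ring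

theorem dot_comm (u v : ℝ × ℝ) : dot u v = dot v u := by
  simp only [dot]; ring

/-- The polar dual point of a line takes the value `1` at the base point and `0` on the
direction vector. -/
theorem dot_eq_of_lineDir_dual {p d N : ℝ × ℝ}
    (h : ∀ x : ℝ × ℝ, x ∈ lineDir p d ↔ dot N x = 1) : dot N p = 1 ∧ dot N d = 0 := by
  have hp : dot N p = 1 := (h p).1 ⟨0, by simp⟩
  have hd : dot N (p + d) = 1 := (h (p + d)).1 ⟨1, by simp⟩
  rw [dot_add_right] at hd
  exact ⟨hp, by linarith⟩

/-- A line that has a polar dual point has a nonzero direction vector. -/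
theorem direction_ne_zero_of_lineDir_dual {p d N : ℝ × ℝ}
    (h : ∀ x : ℝ × ℝ, x ∈ lineDir p d ↔ dot N x = 1) : d ≠ 0 := by
  rintro rfl
  have hp := (dot_eq_of_lineDir_dual h).1
  obtain ⟨t, ht⟩ := (h (p + (-N.2, N.1))).2 (by
    rw [dot_add_right, hp]; simp only [dot]; ring)
  have h₁ : N.2 = 0 := by simpa using congrArg Prod.fst ht
  have h₂ : N.1 = 0 := by simpa using congrArg Prod.snd ht
  simp [dot, h₁, h₂] at hp

/-- A vector of `ℝ²` is determined by its products with `p` and `d`, if some `S` satisfies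
`dot S p = 1` and `dot S d = 0` with `d ≠ 0`. -/
theorem eq_of_dot_eq {p d S M : ℝ × ℝ} (hd : d ≠ 0) (hSp : dot S p = 1) (hSd : dot S d = 0)
    (hMp : dot M p = 1) (hMd : dot M d = 0) : S = M := by
  simp only [dot] at *
  have hdet : p.1 * d.2 - p.2 * d.1 ≠ 0 := by
    intro h
    apply hd
    ext
    · simp only [Prod.fst_zero]
      linear_combination (-d.1) * hSp + p.1 * hSd - S.2 * h
    · simp only [Prod.snd_zero]
      linear_combination (-d.2) * hSp + p.2 * hSd + S.1 * h
  ext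
  · apply mul_left_cancel₀ hdet
    linear_combination d.2 * (hSp - hMp) - p.2 * (hSd - hMd)
  · apply mul_left_cancel₀ hdet
    linear_combination p.1 * (hSd - hMd) - d.1 * (hSp - hMp)

/-- If `(ℓ, ℓ'; L, T)` is a harmonic quadruple of lines through `p ≠ 0` with `L` passing
through the origin, and `N, N', S` are the polar dual points of `ℓ, ℓ', T` with respect
to the origin (so that e.g. `ℓ = {x : dot N x = 1}`), then `N, N', S` lie on the dual
line `p* = {x : dot p x = 1}` and `S` is the midpoint of `N` and `N'`. -/
theorem harmonic_polar_dual_midpoint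
    (p dl dl' dL dT N N' S : ℝ × ℝ) (hp : p ≠ 0)
    (hL0 : (0 : ℝ × ℝ) ∈ lineDir p dL)
    (hl0 : (0 : ℝ × ℝ) ∉ lineDir p dl) (hl'0 : (0 : ℝ × ℝ) ∉ lineDir p dl')
    (hT0 : (0 : ℝ × ℝ) ∉ lineDir p dT)
    (hharm : HarmonicLines dl dl' dL dT)
    (hN : ∀ x : ℝ × ℝ, x ∈ lineDir p dl ↔ dot N x = 1)
    (hN' : ∀ x : ℝ × ℝ, x ∈ lineDir p dl' ↔ dot N' x = 1)
    (hS : ∀ x : ℝ × ℝ, x ∈ lineDir p dT ↔ dot S x = 1) :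
    dot p N = 1 ∧ dot p N' = 1 ∧ dot p S = 1 ∧ S = midpoint ℝ N N' := by
  obtain ⟨hNp, hNd⟩ := dot_eq_of_lineDir_dual hN
  obtain ⟨hNp', hNd'⟩ := dot_eq_of_lineDir_dual hN'
  obtain ⟨hSp, hSd⟩ := dot_eq_of_lineDir_dual hS
  refine ⟨dot_comm p N ▸ hNp, dot_comm p N' ▸ hNp', dot_comm p S ▸ hSp, ?_⟩
  obtain ⟨r, hr⟩ := hL0
  obtain ⟨a, b, -, hb, ⟨s, hs, rfl⟩, ⟨t, ht, rfl⟩⟩ := hharm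
  have hpL : p = (-r) • dL := by rw [neg_smul]; exact eq_neg_of_add_eq_zero_left hr.symm
  have hr0 : -r ≠ 0 := by
    intro h
    rw [h, zero_smul] at hpL
    exact hp hpL
  have hLL : dot N dL = dot N' dL := by
    apply mul_left_cancel₀ hr0
    rw [← dot_smul_right, ← dot_smul_right, ← hpL, hNp, hNp']
  rw [dot_smul_right, dot_add_right, dot_smul_right, dot_smul_right] at hNd
  rw [dot_smul_right, dot_sub_right, dot_smul_right, dot_smul_right] at hNd'
  have hsum : dot N dT + dot N' dT = 0 := by
    apply (mul_eq_zero.1 _).resolve_left hb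
    linear_combination (mul_eq_zero.1 hNd).resolve_left hs
      - (mul_eq_zero.1 hNd').resolve_left ht - a * hLL
  have hmid (x : ℝ × ℝ) : dot (midpoint ℝ N N') x = (dot N x + dot N' x) / 2 := by
    simp only [midpoint_eq_smul_add, dot_comm _ x, dot_smul_right, dot_add_right,
      invOf_eq_inv]
    ring
  exact eq_of_dot_eq (direction_ne_zero_of_lineDir_dual hS) hSp hSd
    (by rw [hmid, hNp, hNp']; norm_num) (by rw [hmid, hsum, zero_div])
end
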